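/- arXiv:2604.24423 — 2 statements merged into one kernel-verified Lean document; each statement's English description precedes it below -/
import Mathlib

section
/- For every real m×m matrix C, the gauge function of the maximal correlation set satisfies: if the column space of C is contained in the column space of A and the column space of Cᵀ is contained in the column space of B, then γ_{C_max}(C) = ‖A⁺ C (Bᵀ)⁺‖_∞, the largest singular value of the real 3×3 matrix A⁺ C (Bᵀ)⁺; otherwise γ_{C_max}(C) = +∞. -/
open Matrix Kronecker
open scoped ENNReal ComplexOrder

namespace BellCorr

/-- The three Pauli matrices. -/
noncomputable def pauli (k : Fin 3) : Matrix (Fin 2) (Fin 2) ℂ :=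
  if k = 0 then !![0, 1; 1, 0]
  else if k = 1 then !![0, -Complex.I; Complex.I, 0]
  else !![1, 0; 0, -1]

/-- The observable `Â_i = ∑ k A i k • σ_k` associated with row `i` of `A`. -/
noncomputable def obs {m : ℕ} (A : Matrix (Fin m) (Fin 3) ℝ) (i : Fin m) :
    Matrix (Fin 2) (Fin 2) ℂ :=
  ∑ k : Fin 3, (A i k : ℂ) • pauli k

/-- The correlation map `Φ_AB`, sending a 4×4 complex matrix to the real m×m matrix
with entries `Tr[ρ (Â_i ⊗ B̂_j)]`. -/
noncomputable def corr {m : ℕ} (A B : Matrix (Fin m) (Fin 3) ℝ)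
    (ρ : Matrix (Fin 2 × Fin 2) (Fin 2 × Fin 2) ℂ) : Matrix (Fin m) (Fin m) ℝ :=
  Matrix.of fun i j => ((ρ * (obs A i ⊗ₖ obs B j)).trace).re

/-- Separable states: convex hull of products of 2×2 PSD trace-one matrices. -/
noncomputable def Ssep : Set (Matrix (Fin 2 × Fin 2) (Fin 2 × Fin 2) ℂ) :=
  convexHull ℝ {ρ | ∃ ρA ρB : Matrix (Fin 2) (Fin 2) ℂ,
    ρA.PosSemidef ∧ ρA.trace = 1 ∧ ρB.PosSemidef ∧ ρB.trace = 1 ∧ ρ = ρA ⊗ₖ ρB}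

/-- Quantum states: 4×4 PSD matrices of trace one. -/
def Sqm : Set (Matrix (Fin 2 × Fin 2) (Fin 2 × Fin 2) ℂ) :=
  {ρ | ρ.PosSemidef ∧ ρ.trace = 1}

/-- Maximal-tensor-product states: self-adjoint trace-one matrices pairing
nonnegatively with every product of PSD matrices. -/
def Smax : Set (Matrix (Fin 2 × Fin 2) (Fin 2 × Fin 2) ℂ) :=
  {ρ | ρ.IsHermitian ∧ ρ.trace = 1 ∧
    ∀ P Q : Matrix (Fin 2) (Fin 2) ℂ, P.PosSemidef → Q.PosSemidef →
      0 ≤ ((ρ * (P ⊗ₖ Q)).trace).re}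

noncomputable def Csep {m : ℕ} (A B : Matrix (Fin m) (Fin 3) ℝ) :
    Set (Matrix (Fin m) (Fin m) ℝ) := corr A B '' Ssep

noncomputable def Cqm {m : ℕ} (A B : Matrix (Fin m) (Fin 3) ℝ) :
    Set (Matrix (Fin m) (Fin m) ℝ) := corr A B '' Sqm

noncomputable def Cmax {m : ℕ} (A B : Matrix (Fin m) (Fin 3) ℝ) :
    Set (Matrix (Fin m) (Fin m) ℝ) := corr A B '' Smax

/-- Support function `φ_K(Z) = sup_{C ∈ K} Tr[Zᵀ C]`. -/
noncomputable def suppFn {m : ℕ} (K : Set (Matrix (Fin m) (Fin m) ℝ))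
    (Z : Matrix (Fin m) (Fin m) ℝ) : ℝ :=
  sSup ((fun C => (Zᵀ * C).trace) '' K)

/-- Gauge function `γ_K(C) = inf {t > 0 : C/t ∈ K}`, with value `+∞` if no such `t` exists. -/
noncomputable def gaugeFn {m : ℕ} (K : Set (Matrix (Fin m) (Fin m) ℝ))
    (C : Matrix (Fin m) (Fin m) ℝ) : ℝ≥0∞ :=
  ⨅ (t : ℝ) (_ : 0 < t ∧ t⁻¹ • C ∈ K), ENNReal.ofReal t

/-- `XᵀX` is Hermitian for a real matrix `X`. -/
lemma isHermitian_tr_mul_self (X : Matrix (Fin 3) (Fin 3) ℝ) : (Xᵀ * X).IsHermitian := by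
  simpa [Matrix.conjTranspose_eq_transpose_of_trivial] using
    Matrix.isHermitian_conjTranspose_mul_self X

/-- The singular values of a real 3×3 matrix, in decreasing order:
`sval X 0 ≥ sval X 1 ≥ sval X 2 ≥ 0` are the square roots of the eigenvalues of `XᵀX`. -/
noncomputable def sval (X : Matrix (Fin 3) (Fin 3) ℝ) (i : Fin 3) : ℝ :=
  Real.sqrt ((isHermitian_tr_mul_self X).eigenvalues
    (Tuple.sort (isHermitian_tr_mul_self X).eigenvalues i.rev))

/-- Column space of a real matrix. -/
noncomputable def colSpace {m n : ℕ} (X : Matrix (Fin m) (Fin n) ℝ) :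
    Submodule ℝ (Fin m → ℝ) := LinearMap.range X.mulVecLin

/-- `Y` is the Moore–Penrose pseudoinverse of `X`. -/
def IsMP {m n : ℕ} (X : Matrix (Fin m) (Fin n) ℝ) (Y : Matrix (Fin n) (Fin m) ℝ) : Prop :=
  X * Y * X = X ∧ Y * X * Y = Y ∧ (X * Y)ᵀ = X * Y ∧ (Y * X)ᵀ = Y * X

/-- The matrix of Pauli correlations `Tr[ρ (σ_k ⊗ σ_l)]` of a two-qubit operator. -/
noncomputable def pauliCorr (ρ : Matrix (Fin 2 × Fin 2) (Fin 2 × Fin 2) ℂ) :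
    Matrix (Fin 3) (Fin 3) ℝ :=
  Matrix.of fun k l => ((ρ * (pauli k ⊗ₖ pauli l)).trace).re

/-- The two-qubit operator with maximally mixed marginals and Pauli correlations `T`. -/
noncomputable def ofPauliCorr (T : Matrix (Fin 3) (Fin 3) ℝ) :
    Matrix (Fin 2 × Fin 2) (Fin 2 × Fin 2) ℂ :=
  (1 / 4 : ℂ) • ((1 : Matrix (Fin 2) (Fin 2) ℂ) ⊗ₖ (1 : Matrix (Fin 2) (Fin 2) ℂ) +
    ∑ k, ∑ l, (T k l : ℂ) • (pauli k ⊗ₖ pauli l))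

/-- The observable `∑ k, a k • σ_k` with Bloch vector `a`. -/
noncomputable def pauliVec (a : Fin 3 → ℝ) : Matrix (Fin 2) (Fin 2) ℂ :=
  ∑ k : Fin 3, (a k : ℂ) • pauli k

lemma trace_mul_pauliVec_kronecker (ρ : Matrix (Fin 2 × Fin 2) (Fin 2 × Fin 2) ℂ)
    (a b : Fin 3 → ℝ) :
    ((ρ * (pauliVec a ⊗ₖ pauliVec b)).trace).re = a ⬝ᵥ (pauliCorr ρ *ᵥ b) := by
  simp only [pauliVec, pauliCorr, Fin.sum_univ_three, add_kronecker, kronecker_add,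
    smul_kronecker, kronecker_smul, mul_add, Matrix.mul_smul, trace_add, trace_smul, smul_eq_mul,
    Complex.add_re, Complex.re_ofReal_mul, dotProduct, mulVec, Matrix.of_apply]
  ring

lemma corr_eq {m : ℕ} (A B : Matrix (Fin m) (Fin 3) ℝ)
    (ρ : Matrix (Fin 2 × Fin 2) (Fin 2 × Fin 2) ℂ) :
    corr A B ρ = A * pauliCorr ρ * Bᵀ := by
  ext i j
  have h := trace_mul_pauliVec_kronecker ρ (A i) (B j)
  simp only [corr, Matrix.of_apply]
  refine h.trans ?_
  rw [Matrix.mul_assoc]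
  rfl

lemma pauli_isHermitian (k : Fin 3) : (pauli k).IsHermitian := by
  fin_cases k <;> ext i j <;> fin_cases i <;> fin_cases j <;> simp [pauli]

lemma trace_pauli (k : Fin 3) : (pauli k).trace = 0 := by
  fin_cases k <;> simp [pauli, Matrix.trace_fin_two]

lemma trace_pauli_mul_pauli (k l : Fin 3) :
    (pauli k * pauli l).trace = if k = l then 2 else 0 := by
  fin_cases k <;> fin_cases l <;> simp [pauli, Matrix.trace_fin_two] <;> norm_num

lemma pauliVec_isHermitian (a : Fin 3 → ℝ) : (pauliVec a).IsHermitian := by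
  simp [pauliVec, Matrix.IsHermitian, conjTranspose_sum, conjTranspose_smul,
    (pauli_isHermitian _).eq]

lemma pauliVec_mul_self (a : Fin 3 → ℝ) :
    pauliVec a * pauliVec a = ((a ⬝ᵥ a : ℝ) : ℂ) • 1 := by
  have hI := Complex.I_sq
  ext i j
  fin_cases i <;> fin_cases j <;>
    simp [pauliVec, pauli, Fin.sum_univ_three, Matrix.mul_apply, Fin.sum_univ_two, dotProduct] <;>
    ring_nf <;> (try rw [hI]) <;> ring

lemma pauliVec_neg (a : Fin 3 → ℝ) : pauliVec (-a) = (-1 : ℂ) • pauliVec a := by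
  simp [pauliVec]

lemma dotProduct_self_nonneg_real {n : ℕ} (v : Fin n → ℝ) : 0 ≤ v ⬝ᵥ v := by
  simpa using dotProduct_self_star_nonneg v

lemma posSemidef_norm_add_pauliVec (a : Fin 3 → ℝ) :
    (((√(a ⬝ᵥ a) : ℝ) : ℂ) • 1 + pauliVec a).PosSemidef := by
  set n := √(a ⬝ᵥ a) with hn
  have hsq : n * n = a ⬝ᵥ a := Real.mul_self_sqrt (dotProduct_self_nonneg_real a)
  rcases (Real.sqrt_nonneg (a ⬝ᵥ a)).eq_or_lt with h0 | hpos
  · have ha : a = 0 := by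
      rw [← hn] at h0
      rw [← h0] at hsq
      exact dotProduct_self_eq_zero.mp (by linarith)
    simp [hn, ha, pauliVec, PosSemidef.zero]
  · rw [← hn] at hpos
    have hH : ((n : ℂ) • 1 + pauliVec a).IsHermitian := by
      refine Matrix.IsHermitian.add ?_ (pauliVec_isHermitian a)
      simp [Matrix.IsHermitian, conjTranspose_smul]
    have hmul : ((n : ℂ) • 1 + pauliVec a)ᴴ * ((n : ℂ) • 1 + pauliVec a) =
        (2 * n : ℂ) • ((n : ℂ) • 1 + pauliVec a) := by
      rw [hH.eq, add_mul, mul_add, mul_add, pauliVec_mul_self, ← hsq]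
      simp only [Matrix.smul_mul, Matrix.mul_smul, Matrix.one_mul, Matrix.mul_one, smul_add,
        smul_smul, Complex.ofReal_mul]
      module
    have hps := (posSemidef_conjTranspose_mul_self ((n : ℂ) • 1 + pauliVec a)).smul
      (show (0 : ℂ) ≤ ((1 / (2 * n) : ℝ) : ℂ) by
        exact_mod_cast (by positivity : 0 ≤ 1 / (2 * n)))
    rw [hmul, smul_smul] at hps
    have hn' : (n : ℂ) ≠ 0 := by exact_mod_cast hpos.ne'
    have h1 : ((1 / (2 * n) : ℝ) : ℂ) * (2 * n) = 1 := by
      push_cast; field_simp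
    rwa [h1, one_smul] at hps

/-- The Bloch vector of a 2×2 matrix. -/
noncomputable def bloch (P : Matrix (Fin 2) (Fin 2) ℂ) (k : Fin 3) : ℝ :=
  ((pauli k * P).trace).re / 2

lemma trace_pauli_mul_of_isHermitian {P : Matrix (Fin 2) (Fin 2) ℂ} (hP : P.IsHermitian)
    (k : Fin 3) : (pauli k * P).trace = ((2 * bloch P k : ℝ) : ℂ) := by
  have h : star (pauli k * P).trace = (pauli k * P).trace := by
    rw [← trace_conjTranspose, conjTranspose_mul, hP.eq, (pauli_isHermitian k).eq, trace_mul_comm]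
  rw [bloch, mul_div_cancel₀ _ two_ne_zero]
  exact (Complex.conj_eq_iff_re.mp h).symm

lemma bloch_dotProduct_self_le {P : Matrix (Fin 2) (Fin 2) ℂ} (hP : P.PosSemidef) :
    bloch P ⬝ᵥ bloch P ≤ (P.trace.re / 2) ^ 2 := by
  have hdet := (Complex.le_def.mp hP.det_nonneg).1
  have h00 := hP.isHermitian.apply 0 0
  have h11 := hP.isHermitian.apply 1 1
  have h01 := hP.isHermitian.apply 0 1
  have e00 := congrArg Complex.im h00
  have e11 := congrArg Complex.im h11
  have r01 := congrArg Complex.re h01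
  have i01 := congrArg Complex.im h01
  simp only [det_fin_two, Complex.zero_re, Complex.sub_re, Complex.mul_re] at hdet
  simp at e00 e11 r01 i01
  simp only [bloch, dotProduct, Fin.sum_univ_three, trace_fin_two, Matrix.mul_apply,
    Fin.sum_univ_two]
  simp [pauli]
  rw [← r01, ← i01] at *
  have e00' : (P 0 0).im = 0 := by linarith
  have e11' : (P 1 1).im = 0 := by linarith
  rw [e00', e11'] at hdet
  nlinarith

lemma trace_ofPauliCorr_mul_kronecker (T : Matrix (Fin 3) (Fin 3) ℝ)
    {P Q : Matrix (Fin 2) (Fin 2) ℂ} (hP : P.IsHermitian) (hQ : Q.IsHermitian) :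
    ((ofPauliCorr T * (P ⊗ₖ Q)).trace).re =
      ((P.trace * Q.trace).re / 4) + bloch P ⬝ᵥ (T *ᵥ bloch Q) := by
  simp only [ofPauliCorr, Matrix.smul_mul, add_mul, Finset.sum_mul, trace_add, trace_smul,
    trace_sum, ← mul_kronecker_mul, trace_kronecker, trace_pauli_mul_of_isHermitian hP,
    trace_pauli_mul_of_isHermitian hQ, Matrix.one_mul]
  simp only [Fin.sum_univ_three, dotProduct, mulVec, smul_eq_mul, ← Complex.ofReal_mul,
    ← Complex.ofReal_add]
  rw [show (1 / 4 : ℂ) = ((1 / 4 : ℝ) : ℂ) by norm_num, Complex.re_ofReal_mul, Complex.add_re,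
    Complex.ofReal_re]
  ring

lemma pauliCorr_ofPauliCorr (T : Matrix (Fin 3) (Fin 3) ℝ) : pauliCorr (ofPauliCorr T) = T := by
  ext k l
  have hb (k j : Fin 3) : bloch (pauli k) j = if j = k then 1 else 0 := by
    rw [bloch, trace_pauli_mul_pauli]
    split_ifs <;> norm_num
  simp [pauliCorr, trace_ofPauliCorr_mul_kronecker T (pauli_isHermitian k) (pauli_isHermitian l),
    trace_pauli, dotProduct, mulVec, hb]

lemma ofPauliCorr_isHermitian (T : Matrix (Fin 3) (Fin 3) ℝ) : (ofPauliCorr T).IsHermitian := by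
  simp [ofPauliCorr, Matrix.IsHermitian, conjTranspose_smul, conjTranspose_sum,
    conjTranspose_kronecker, (pauli_isHermitian _).eq]

lemma trace_ofPauliCorr (T : Matrix (Fin 3) (Fin 3) ℝ) : (ofPauliCorr T).trace = 1 := by
  simp [ofPauliCorr, trace_sum, trace_kronecker, trace_pauli]

/-- `X` has Euclidean operator norm at most `s`. -/
def OpNormLE {n : ℕ} (X : Matrix (Fin n) (Fin n) ℝ) (s : ℝ) : Prop :=
  ∀ v, (X *ᵥ v) ⬝ᵥ (X *ᵥ v) ≤ s ^ 2 * (v ⬝ᵥ v)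

lemma dotProduct_sq_le {n : ℕ} (v w : Fin n → ℝ) :
    (v ⬝ᵥ w) ^ 2 ≤ (v ⬝ᵥ v) * (w ⬝ᵥ w) := by
  simpa [dotProduct, sq] using Finset.sum_mul_sq_le_sq_mul_sq Finset.univ v w

lemma ofPauliCorr_mem_Smax {T : Matrix (Fin 3) (Fin 3) ℝ} (hT : OpNormLE T 1) :
    ofPauliCorr T ∈ Smax := by
  refine ⟨ofPauliCorr_isHermitian T, trace_ofPauliCorr T, fun P Q hP hQ => ?_⟩
  rw [trace_ofPauliCorr_mul_kronecker T hP.isHermitian hQ.isHermitian]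
  have hp := Complex.le_def.mp hP.trace_nonneg
  have hq := Complex.le_def.mp hQ.trace_nonneg
  simp only [Complex.zero_re, Complex.zero_im] at hp hq
  have hbP := bloch_dotProduct_self_le hP
  have hbQ := bloch_dotProduct_self_le hQ
  have hTQ := hT (bloch Q)
  rw [Complex.mul_re, ← hp.2, zero_mul, sub_zero]
  have hsq : (bloch P ⬝ᵥ (T *ᵥ bloch Q)) ^ 2 ≤ (P.trace.re / 2 * (Q.trace.re / 2)) ^ 2 := by
    rw [mul_pow]
    refine (dotProduct_sq_le _ _).trans ?_
    exact mul_le_mul hbP (by linarith) (dotProduct_self_nonneg_real _) (sq_nonneg _)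
  have h0 : 0 ≤ P.trace.re / 2 * (Q.trace.re / 2) :=
    mul_nonneg (by linarith [hp.1]) (by linarith [hq.1])
  have := (abs_le_of_sq_le_sq' hsq h0).1
  linarith

lemma opNormLE_pauliCorr {ρ : Matrix (Fin 2 × Fin 2) (Fin 2 × Fin 2) ℂ} (hρ : ρ ∈ Smax) :
    OpNormLE (pauliCorr ρ) 1 := by
  have key (a b : Fin 3 → ℝ) : 0 ≤ √(a ⬝ᵥ a) * √(b ⬝ᵥ b) + a ⬝ᵥ (pauliCorr ρ *ᵥ b) := by
    have h1 := hρ.2.2 _ _ (posSemidef_norm_add_pauliVec a) (posSemidef_norm_add_pauliVec b)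
    have h2 := hρ.2.2 _ _ (posSemidef_norm_add_pauliVec (-a)) (posSemidef_norm_add_pauliVec (-b))
    rw [← trace_mul_pauliVec_kronecker]
    simp only [pauliVec_neg, dotProduct_neg, neg_dotProduct, neg_neg] at h2
    have hs := add_nonneg h1 h2
    simp only [add_kronecker, kronecker_add, smul_kronecker, kronecker_smul, mul_add,
      Matrix.mul_smul, trace_add, trace_smul, smul_eq_mul, Complex.add_re, Complex.re_ofReal_mul,
      one_kronecker_one, Matrix.mul_one, hρ.2.1, Complex.one_re, neg_mul, one_mul,
      Complex.neg_re, mul_neg] at hs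
    linarith
  intro v
  set w := pauliCorr ρ *ᵥ v
  have h := key (-w) v
  simp only [dotProduct_neg, neg_dotProduct, neg_neg] at h
  change 0 ≤ √(w ⬝ᵥ w) * √(v ⬝ᵥ v) + -(w ⬝ᵥ w) at h
  have hw := Real.mul_self_sqrt (dotProduct_self_nonneg_real w)
  have hv := Real.mul_self_sqrt (dotProduct_self_nonneg_real v)
  have hw0 := Real.sqrt_nonneg (w ⬝ᵥ w)
  have hv0 := Real.sqrt_nonneg (v ⬝ᵥ v)
  have hle : √(w ⬝ᵥ w) ≤ √(v ⬝ᵥ v) := by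
    rcases hw0.eq_or_lt with h0 | hpos
    · rw [← h0]; exact hv0
    · exact le_of_mul_le_mul_left (by linarith) hpos
  nlinarith

lemma mem_Cmax_iff {m : ℕ} (A B : Matrix (Fin m) (Fin 3) ℝ) (C : Matrix (Fin m) (Fin m) ℝ) :
    C ∈ Cmax A B ↔ ∃ T : Matrix (Fin 3) (Fin 3) ℝ, OpNormLE T 1 ∧ C = A * T * Bᵀ := by
  constructor
  · rintro ⟨ρ, hρ, rfl⟩
    exact ⟨_, opNormLE_pauliCorr hρ, corr_eq A B ρ⟩
  · rintro ⟨T, hT, rfl⟩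
    exact ⟨_, ofPauliCorr_mem_Smax hT, by rw [corr_eq, pauliCorr_ofPauliCorr]⟩

lemma opNormLE_one_mul_mul {n : ℕ} {T P Q : Matrix (Fin n) (Fin n) ℝ} (hT : OpNormLE T 1)
    (hP : OpNormLE P 1) (hQ : OpNormLE Q 1) : OpNormLE (P * T * Q) 1 := by
  intro v
  have h1 := hP (T *ᵥ (Q *ᵥ v))
  have h2 := hT (Q *ᵥ v)
  have h3 := hQ v
  rw [← mulVec_mulVec, ← mulVec_mulVec]
  linarith

lemma opNormLE_one_of_isSymm_of_mul_self {n : ℕ} {P : Matrix (Fin n) (Fin n) ℝ}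
    (hs : Pᵀ = P) (hi : P * P = P) : OpNormLE P 1 := by
  intro v
  have h : (P *ᵥ v) ⬝ᵥ (P *ᵥ v) = v ⬝ᵥ (P *ᵥ v) := by
    rw [dotProduct_mulVec, vecMul_mulVec, hs, hi, ← dotProduct_mulVec]
  have h0 := dotProduct_self_nonneg_real (v - P *ᵥ v)
  rw [sub_dotProduct, dotProduct_sub, dotProduct_sub, h, dotProduct_comm (P *ᵥ v) v] at h0
  linarith

lemma OpNormLE.smul {n : ℕ} {X : Matrix (Fin n) (Fin n) ℝ} {s : ℝ} (h : OpNormLE X s) (c : ℝ) :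
    OpNormLE (c • X) (c * s) := by
  intro v
  simp only [smul_mulVec, smul_dotProduct, dotProduct_smul, smul_eq_mul]
  nlinarith [mul_le_mul_of_nonneg_left (h v) (sq_nonneg c)]

lemma sval_zero_le_iff (X : Matrix (Fin 3) (Fin 3) ℝ) {s : ℝ} (hs : 0 ≤ s) :
    sval X 0 ≤ s ↔ OpNormLE X s := by
  set hX := isHermitian_tr_mul_self X
  set j := Tuple.sort hX.eigenvalues (Fin.rev 0) with hj
  have hmax (i : Fin 3) : hX.eigenvalues i ≤ hX.eigenvalues j := by
    have := Tuple.monotone_sort hX.eigenvalues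
      (show (Tuple.sort hX.eigenvalues).symm i ≤ Fin.rev 0 from Fin.le_last _)
    simpa [hj] using this
  have hquad (v : Fin 3 → ℝ) : (X *ᵥ v) ⬝ᵥ (X *ᵥ v) = v ⬝ᵥ ((Xᵀ * X) *ᵥ v) := by
    rw [dotProduct_mulVec, vecMul_mulVec, ← dotProduct_mulVec]
  rw [sval, Real.sqrt_le_left hs]
  constructor
  · intro h v
    have hexp (x y : Fin 3 → ℝ) :
        x ⬝ᵥ y = ∑ i, (⇑(hX.eigenvectorBasis i) ⬝ᵥ x) * (⇑(hX.eigenvectorBasis i) ⬝ᵥ y) := by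
      have := hX.eigenvectorBasis.sum_inner_mul_inner (WithLp.toLp 2 x) (WithLp.toLp 2 y)
      simp only [EuclideanSpace.inner_eq_star_dotProduct, star_trivial] at this
      rw [dotProduct_comm, ← this]
      exact Finset.sum_congr rfl fun i _ => by rw [dotProduct_comm y]
    have hM (i : Fin 3) : ⇑(hX.eigenvectorBasis i) ⬝ᵥ ((Xᵀ * X) *ᵥ v) =
        hX.eigenvalues i * (⇑(hX.eigenvectorBasis i) ⬝ᵥ v) := by
      have hsymm : (Xᵀ * X)ᵀ = Xᵀ * X := by simp
      rw [dotProduct_mulVec, ← mulVec_transpose, hsymm, hX.mulVec_eigenvectorBasis,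
        smul_dotProduct, smul_eq_mul]
    rw [hquad, hexp v ((Xᵀ * X) *ᵥ v), hexp v v, Finset.mul_sum]
    refine Finset.sum_le_sum fun i _ => ?_
    rw [hM]
    nlinarith [mul_le_mul_of_nonneg_right ((hmax i).trans h)
      (mul_self_nonneg (⇑(hX.eigenvectorBasis i) ⬝ᵥ v))]
  · intro h
    set u : Fin 3 → ℝ := ⇑(hX.eigenvectorBasis j)
    have hu : (Xᵀ * X) *ᵥ u = hX.eigenvalues j • u := hX.mulVec_eigenvectorBasis j
    have huu : u ⬝ᵥ u = 1 := by
      have h1 := hX.eigenvectorBasis.orthonormal.1 j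
      rw [← sq_eq_sq₀ (norm_nonneg _) zero_le_one, EuclideanSpace.real_norm_sq_eq] at h1
      simpa [dotProduct, sq, u] using h1
    have := h u
    rw [hquad, hu, dotProduct_smul, huu] at this
    simpa [hj] using this

lemma mul_eq_self_of_colSpace_le {m n l : ℕ} {A : Matrix (Fin m) (Fin n) ℝ}
    {Y : Matrix (Fin n) (Fin m) ℝ} (h : A * Y * A = A) {C : Matrix (Fin m) (Fin l) ℝ}
    (hC : colSpace C ≤ colSpace A) : A * Y * C = C := by
  refine Matrix.ext_of_mulVec_single fun j => ?_
  obtain ⟨w, hw⟩ := hC ⟨Pi.single j 1, rfl⟩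
  simp only [mulVecLin_apply] at hw
  rw [← mulVec_mulVec, ← hw, mulVec_mulVec, h]

lemma colSpace_mul_le {m n l : ℕ} (A : Matrix (Fin m) (Fin n) ℝ) (D : Matrix (Fin n) (Fin l) ℝ) :
    colSpace (A * D) ≤ colSpace A := by
  rintro _ ⟨w, rfl⟩
  exact ⟨D *ᵥ w, by simp⟩

/-- Gauge function of the maximal correlation set:
`γ_{C_max}(C) = ‖A⁺ C (Bᵀ)⁺‖_∞` under the range conditions, and `+∞` otherwise. -/
theorem stmt7 {m : ℕ} (hm : 1 ≤ m) (A B : Matrix (Fin m) (Fin 3) ℝ)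
    (hA : ∀ i, ∑ k, A i k ^ 2 = 1) (hB : ∀ i, ∑ k, B i k ^ 2 = 1)
    (C : Matrix (Fin m) (Fin m) ℝ)
    (Ap : Matrix (Fin 3) (Fin m) ℝ) (Bp : Matrix (Fin m) (Fin 3) ℝ)
    (hAp : IsMP A Ap) (hBp : IsMP Bᵀ Bp) :
    (colSpace C ≤ colSpace A ∧ colSpace Cᵀ ≤ colSpace B →
      gaugeFn (Cmax A B) C = ENNReal.ofReal (sval (Ap * C * Bp) 0)) ∧
    (¬(colSpace C ≤ colSpace A ∧ colSpace Cᵀ ≤ colSpace B) →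
      gaugeFn (Cmax A B) C = ⊤) := by
  have hC_of_mem {t : ℝ} (ht : 0 < t) {T : Matrix (Fin 3) (Fin 3) ℝ}
      (h : t⁻¹ • C = A * T * Bᵀ) : C = A * (t • T) * Bᵀ := by
    rw [Matrix.mul_smul, Matrix.smul_mul, ← h, smul_inv_smul₀ ht.ne']
  constructor
  · rintro ⟨h1, h2⟩
    have hC : A * (Ap * C * Bp) * Bᵀ = C := by
      have e1 := mul_eq_self_of_colSpace_le hAp.1 h1
      have hB' : B * Bpᵀ * B = B := by
        simpa [Matrix.mul_assoc] using congrArg transpose hBp.1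
      have e2 : C * (Bp * Bᵀ) = C := by
        simpa using congrArg transpose (mul_eq_self_of_colSpace_le hB' h2)
      calc A * (Ap * C * Bp) * Bᵀ = A * Ap * C * (Bp * Bᵀ) := by simp only [Matrix.mul_assoc]
        _ = C := by rw [e1, e2]
    have hiff (t : ℝ) (ht : 0 < t) : t⁻¹ • C ∈ Cmax A B ↔ sval (Ap * C * Bp) 0 ≤ t := by
      rw [mem_Cmax_iff, sval_zero_le_iff _ ht.le]
      constructor
      · rintro ⟨T, hT, h⟩
        have e : Ap * C * Bp = t • ((Ap * A) * T * (Bᵀ * Bp)) := by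
          rw [hC_of_mem ht h]
          simp only [Matrix.mul_assoc, Matrix.mul_smul, Matrix.smul_mul]
        have hPA : OpNormLE (Ap * A) 1 := opNormLE_one_of_isSymm_of_mul_self hAp.2.2.2
          (by rw [← Matrix.mul_assoc, hAp.2.1])
        have hPB : OpNormLE (Bᵀ * Bp) 1 := opNormLE_one_of_isSymm_of_mul_self hBp.2.2.1
          (by rw [← Matrix.mul_assoc, hBp.1])
        simpa [e] using (opNormLE_one_mul_mul hT hPA hPB).smul t
      · intro h
        refine ⟨t⁻¹ • (Ap * C * Bp), ?_, ?_⟩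
        · simpa [ht.ne'] using h.smul t⁻¹
        · rw [Matrix.mul_smul, Matrix.smul_mul, hC]
    apply le_antisymm
    · refine ENNReal.le_of_forall_pos_le_add fun ε hε _ => ?_
      have hs : 0 ≤ sval (Ap * C * Bp) 0 := Real.sqrt_nonneg _
      have hpos : 0 < sval (Ap * C * Bp) 0 + ε := add_pos_of_nonneg_of_pos hs hε
      refine (iInf₂_le (sval (Ap * C * Bp) 0 + ε) ⟨hpos, (hiff _ hpos).2 (by simp)⟩).trans ?_
      exact ENNReal.ofReal_add_le.trans_eq (by rw [ENNReal.ofReal_coe_nnreal])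
    · exact le_iInf₂ fun t ht => ENNReal.ofReal_le_ofReal ((hiff t ht.1).1 ht.2)
  · intro hn
    rw [gaugeFn, iInf₂_eq_top]
    rintro t ⟨ht, hmem⟩
    obtain ⟨T, -, h⟩ := (mem_Cmax_iff _ _ _).1 hmem
    refine absurd ?_ hn
    rw [hC_of_mem ht h]
    refine ⟨?_, ?_⟩
    · rw [Matrix.mul_assoc]
      exact colSpace_mul_le _ _
    · rw [transpose_mul, transpose_transpose]
      exact colSpace_mul_le _ _

end BellCorr
end

section
/- (Rigidity of extremal correlations) Let r_A, r_B ∈ ℝ³ and T ∈ M_3(ℝ), and let ρ := (1/4)( I_4 + Σ_{i=1}^3 (r_A)_i σ_i ⊗ I_2 + Σ_{j=1}^3 (r_B)_j I_2 ⊗ σ_j + Σ_{i,j=1}^3 T_{ij} σ_i ⊗ σ_j ). If ρ is block positive, i.e., Tr[ρ (P ⊗ Q)] ≥ 0 for all 2×2 positive semidefinite matrices P and Q, and T is orthogonal (TᵀT = I_3), then r_A = 0 and r_B = 0. -/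
open Matrix Kronecker
open scoped ENNReal ComplexOrder

namespace BellCorr

/-- The operator `t + a · σ`. -/
noncomputable def blochOp (t : ℝ) (a : Fin 3 → ℝ) : Matrix (Fin 2) (Fin 2) ℂ :=
  !![t + a 2, a 0 - a 1 * Complex.I; a 0 + a 1 * Complex.I, t - a 2]

lemma blochOp_posSemidef {t : ℝ} (ht : 0 < t) {a : Fin 3 → ℝ} (ha : a ⬝ᵥ a = t ^ 2) :
    (blochOp t a).PosSemidef := by
  have ha' : (a 0 * a 0 + a 1 * a 1 + a 2 * a 2 : ℂ) = t ^ 2 := by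
    rw [dotProduct, Fin.sum_univ_three] at ha
    exact_mod_cast ha
  have h : (blochOp t a)ᴴ * blochOp t a = (2 * t) • blochOp t a := by
    ext i j
    fin_cases i <;> fin_cases j <;> simp [blochOp, Matrix.mul_apply, Fin.sum_univ_two]
    · linear_combination ha' - (a 1 : ℂ) ^ 2 * Complex.I_sq
    · ring
    · ring
    · linear_combination ha' - (a 1 : ℂ) ^ 2 * Complex.I_sq
  have hp := (Matrix.posSemidef_conjTranspose_mul_self (blochOp t a)).smul
    (show (0 : ℝ) ≤ (2 * t)⁻¹ by positivity)
  rwa [h, inv_smul_smul₀ (by positivity)] at hp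

lemma pauli_zero : pauli 0 = !![0, 1; 1, 0] := by simp [pauli]

lemma pauli_one : pauli 1 = !![0, -Complex.I; Complex.I, 0] := by simp [pauli]

lemma pauli_two : pauli 2 = !![1, 0; 0, -1] := by simp [pauli]

lemma trace_blochOp (t : ℝ) (a : Fin 3 → ℝ) : (blochOp t a).trace = 2 * t := by
  simp [blochOp, Matrix.trace_fin_two]; ring

lemma trace_pauli_mul_blochOp (t : ℝ) (a : Fin 3 → ℝ) (i : Fin 3) :
    (pauli i * blochOp t a).trace = 2 * a i := by
  fin_cases i <;>
    simp [pauli_zero, pauli_one, pauli_two, blochOp, Matrix.trace_fin_two] <;>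
    ring_nf
  simp

lemma re_trace_mul_blochOp (rA rB : Fin 3 → ℝ) (T : Matrix (Fin 3) (Fin 3) ℝ)
    (s t : ℝ) (a b : Fin 3 → ℝ) :
    (((1 / 4 : ℂ) •
      ((1 : Matrix (Fin 2 × Fin 2) (Fin 2 × Fin 2) ℂ) +
        ∑ i : Fin 3, (rA i : ℂ) • (pauli i ⊗ₖ (1 : Matrix (Fin 2) (Fin 2) ℂ)) +
        ∑ j : Fin 3, (rB j : ℂ) • ((1 : Matrix (Fin 2) (Fin 2) ℂ) ⊗ₖ pauli j) +
        ∑ i : Fin 3, ∑ j : Fin 3, (T i j : ℂ) • (pauli i ⊗ₖ pauli j)) *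
      (blochOp s a ⊗ₖ blochOp t b)).trace).re =
      s * t + t * (rA ⬝ᵥ a) + s * (rB ⬝ᵥ b) + a ⬝ᵥ T *ᵥ b := by
  rw [← Matrix.one_kronecker_one (α := ℂ) (m := Fin 2) (n := Fin 2)]
  simp only [Matrix.smul_mul, Matrix.add_mul, Matrix.sum_mul, Matrix.trace_smul,
    Matrix.trace_add, Matrix.trace_sum, ← Matrix.mul_kronecker_mul, Matrix.trace_kronecker,
    Matrix.one_mul, trace_blochOp, trace_pauli_mul_blochOp, smul_eq_mul]
  rw [← Complex.ofReal_re (s * t + t * (rA ⬝ᵥ a) + s * (rB ⬝ᵥ b) + a ⬝ᵥ T *ᵥ b)]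
  congr 1
  simp only [dotProduct, Matrix.mulVec, Fin.sum_univ_three]
  push_cast
  ring

/-- If `t² + t (u · a + w · c) + a · c` is nonnegative whenever `|a| = |c| = t`,
then `u` and `w` vanish. -/
lemma eq_zero_of_forall_nonneg {u w : Fin 3 → ℝ}
    (h : ∀ t : ℝ, 0 < t → ∀ a c : Fin 3 → ℝ, a ⬝ᵥ a = t ^ 2 → c ⬝ᵥ c = t ^ 2 →
      0 ≤ t ^ 2 + t * (u ⬝ᵥ a + w ⬝ᵥ c) + a ⬝ᵥ c) :
    u = 0 ∧ w = 0 := by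
  have huw : u = w := by
    ext i
    have h₁ := h 1 one_pos (Pi.single i 1) (-Pi.single i 1) (by simp) (by simp)
    have h₂ := h 1 one_pos (-Pi.single i 1) (Pi.single i 1) (by simp) (by simp)
    simp at h₁ h₂
    linarith
  subst huw
  suffices hu : u = 0 from ⟨hu, hu⟩
  ext i
  obtain ⟨j, hj⟩ : ∃ j : Fin 3, i ≠ j := ⟨i + 1, by fin_cases i <;> decide⟩
  obtain ⟨y, hy⟩ : ∃ y : ℝ, y * y = 1 + u i ^ 2 + u i ^ 4 :=
    ⟨_, Real.mul_self_sqrt (by positivity)⟩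
  have h₁ := h (1 + u i ^ 2) (by positivity)
    (Pi.single i (-u i) + Pi.single j y) (Pi.single i (-u i) - Pi.single j y)
    (by simp [hj, hj.symm]; linarith) (by simp [hj, hj.symm]; linarith)
  simp [dotProduct_add, dotProduct_sub, hj, hj.symm] at h₁
  have h₂ : 0 ≤ -(2 * u i ^ 4) := by linarith
  exact pow_eq_zero_iff (n := 4) (by norm_num) |>.mp (by nlinarith [sq_nonneg (u i ^ 2)])

/-- Rigidity of extremal correlations: a block-positive two-qubit operator
with orthogonal correlation matrix has vanishing local Bloch vectors. -/
theorem stmt12 (rA rB : Fin 3 → ℝ) (T : Matrix (Fin 3) (Fin 3) ℝ)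
    (ρ : Matrix (Fin 2 × Fin 2) (Fin 2 × Fin 2) ℂ)
    (hρ : ρ = (1 / 4 : ℂ) •
      ((1 : Matrix (Fin 2 × Fin 2) (Fin 2 × Fin 2) ℂ) +
        ∑ i : Fin 3, (rA i : ℂ) • (pauli i ⊗ₖ (1 : Matrix (Fin 2) (Fin 2) ℂ)) +
        ∑ j : Fin 3, (rB j : ℂ) • ((1 : Matrix (Fin 2) (Fin 2) ℂ) ⊗ₖ pauli j) +
        ∑ i : Fin 3, ∑ j : Fin 3, (T i j : ℂ) • (pauli i ⊗ₖ pauli j)))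
    (hbp : ∀ P Q : Matrix (Fin 2) (Fin 2) ℂ, P.PosSemidef → Q.PosSemidef →
      0 ≤ ((ρ * (P ⊗ₖ Q)).trace).re)
    (hT : Tᵀ * T = 1) :
    rA = 0 ∧ rB = 0 := by
  subst hρ
  have hT' : T * Tᵀ = 1 := mul_eq_one_comm.mp hT
  have key : rA = 0 ∧ T *ᵥ rB = 0 := by
    refine eq_zero_of_forall_nonneg fun t ht a c ha hc => ?_
    have hb : (Tᵀ *ᵥ c) ⬝ᵥ (Tᵀ *ᵥ c) = t ^ 2 := by
      rw [dotProduct_mulVec, vecMul_transpose, mulVec_mulVec, hT', one_mulVec, hc]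
    have h := hbp _ _ (blochOp_posSemidef ht ha) (blochOp_posSemidef ht hb)
    rw [re_trace_mul_blochOp, mulVec_mulVec, hT', one_mulVec, dotProduct_mulVec,
      vecMul_transpose] at h
    linarith
  refine ⟨key.1, ?_⟩
  rw [← one_mulVec rB, ← hT, ← mulVec_mulVec, key.2, mulVec_zero]

end BellCorr
end
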